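/- Let G = N ⋊ ℤ, where N is a finitely generated abelian group and a fixed generator of ℤ acts on N by a group automorphism. Make ℚ ⊗_ℤ N a ℚ[x]-module by letting x act via this automorphism, and suppose ℚ ⊗_ℤ N is isomorphic as a ℚ[x]-module to ⊕_{j=1}^d ℚ[x]/(a_j) where a_1 | a_2 | ⋯ | a_d in ℚ[x] and a_1 is not a unit. Let ρ₁ be the number of distinct roots of a_1 in ℂ. Then there is a constant C such that m_n(G) ≤ ρ₁·n^d + C·n^{d−1} for all sufficiently large n, and m_n(G) ≥ ρ₁·n^d for infinitely many n. -/

import Mathlib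

open Polynomial TensorProduct

/-- The number of maximal subgroups of `G` of index `n`. -/
noncomputable def maxSubgroupCount (G : Type*) [Group G] (n : ℕ) : ℕ :=
  Nat.card {H : Subgroup G // IsCoatom H ∧ H.index = n}

/-- The semidirect product `N ⋊ ℤ` in which a fixed generator of `ℤ` acts on the
abelian group `N` via the automorphism `θ`. -/
abbrev abelianByZ (N : Type*) [AddCommGroup N] (θ : N ≃+ N) : Type _ :=
  SemidirectProduct (Multiplicative N) (Multiplicative ℤ)
    (zpowersHom (MulAut (Multiplicative N)) (AddEquiv.toMultiplicative θ))

theorem Subgroup.isCoatom_of_prime_index {G : Type*} [Group G] {H : Subgroup G}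
    (hH : H.index.Prime) : IsCoatom H := by
  refine ⟨fun h => hH.ne_one (Subgroup.index_eq_one.mpr h), fun K hK => ?_⟩
  have h := Subgroup.relIndex_mul_index hK.le
  rcases Nat.prime_mul_iff.mp (h ▸ hH) with ⟨_, h1⟩ | ⟨_, h1⟩
  · exact Subgroup.index_eq_one.mp h1
  · exact absurd (Subgroup.relIndex_eq_one.mp h1) hK.not_ge

section AbelianByZ

variable {N : Type*} [AddCommGroup N] (θ : N ≃+ N)

/-- The inclusion of `N` in `abelianByZ N θ`, written additively on the source. -/
def abelianByZ.emb (v : N) : abelianByZ N θ := SemidirectProduct.inl (Multiplicative.ofAdd v)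

/-- The fixed generator of `ℤ` in `abelianByZ N θ`. -/
def abelianByZ.gen : abelianByZ N θ := SemidirectProduct.inr (Multiplicative.ofAdd (1 : ℤ))

namespace abelianByZ

theorem emb_zero : emb θ 0 = 1 := map_one SemidirectProduct.inl

theorem emb_add (v w : N) : emb θ (v + w) = emb θ v * emb θ w :=
  map_mul SemidirectProduct.inl (Multiplicative.ofAdd v) (Multiplicative.ofAdd w)

theorem emb_neg (v : N) : emb θ (-v) = (emb θ v)⁻¹ :=
  map_inv SemidirectProduct.inl (Multiplicative.ofAdd v)

theorem emb_sub (v w : N) : emb θ (v - w) = emb θ v * (emb θ w)⁻¹ := by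
  rw [sub_eq_add_neg, emb_add, emb_neg]

theorem gen_conj_emb (v : N) : gen θ * emb θ v * (gen θ)⁻¹ = emb θ (θ v) := by
  have h := SemidirectProduct.inl_aut
    (φ := zpowersHom (MulAut (Multiplicative N)) (AddEquiv.toMultiplicative θ))
    (Multiplicative.ofAdd (1 : ℤ)) (Multiplicative.ofAdd v)
  rw [map_inv] at h
  rw [gen, emb, ← h]
  simp [emb]

theorem gen_zpow (k : ℤ) : gen θ ^ k = SemidirectProduct.inr (Multiplicative.ofAdd k) := by
  rw [gen, ← map_zpow, ← ofAdd_zsmul, smul_eq_mul, mul_one]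

theorem exists_eq_emb_mul_gen_zpow (x : abelianByZ N θ) :
    ∃ (v : N) (k : ℤ), x = emb θ v * gen θ ^ k :=
  ⟨x.left.toAdd, x.right.toAdd, by
    rw [gen_zpow]; exact (SemidirectProduct.inl_left_mul_inr_right x).symm⟩

theorem exists_eq_emb_mul_zpow (v₀ : N) (x : abelianByZ N θ) :
    ∃ (v : N) (k : ℤ), x = emb θ v * (emb θ v₀ * gen θ) ^ k := by
  refine ⟨(x * ((emb θ v₀ * gen θ) ^ x.right.toAdd)⁻¹).left.toAdd, x.right.toAdd, ?_⟩
  rw [← mul_inv_eq_iff_eq_mul]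
  set y := x * ((emb θ v₀ * gen θ) ^ x.right.toAdd)⁻¹ with hy
  have h : y.right = 1 := by
    have : SemidirectProduct.rightHom (emb θ v₀ * gen θ) = Multiplicative.ofAdd (1 : ℤ) := by
      simp [emb, gen]
    rw [← SemidirectProduct.rightHom_eq_right, hy, map_mul, map_inv, map_zpow, this,
      ← ofAdd_zsmul]
    simp
  conv_lhs => rw [← SemidirectProduct.inl_left_mul_inr_right y, h, map_one, mul_one]
  rfl

theorem eq_of_mem_iff {H H' : Subgroup (abelianByZ N θ)} {v₀ : N}
    (h : ∀ v, emb θ v ∈ H ↔ emb θ v ∈ H') (hH : emb θ v₀ * gen θ ∈ H)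
    (hH' : emb θ v₀ * gen θ ∈ H') : H = H' := by
  ext x
  obtain ⟨v, k, rfl⟩ := exists_eq_emb_mul_zpow θ v₀ x
  rw [H.mul_mem_cancel_right (H.zpow_mem hH k), H'.mul_mem_cancel_right (H'.zpow_mem hH' k), h]

/-- The action on `F` where `N` acts by translations through `φ` and the generator acts by
`y ↦ α * y - c`. -/
theorem exists_affine_hom {F : Type*} [Field F] (φ : N →+ F) (α c : F) (hα : α ≠ 0)
    (hφ : ∀ v, φ (θ v) = α * φ v) :
    ∃ ρ : abelianByZ N θ →* Equiv.Perm F, (∀ v y, ρ (emb θ v) y = y + φ v) ∧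
      ∀ y, ρ (gen θ) y = α * y - c := by
  let τ : Multiplicative N →* Equiv.Perm F :=
    { toFun := fun v => Equiv.addRight (φ v.toAdd)
      map_one' := by ext y; simp
      map_mul' := fun v w => by ext y; simp; ring }
  let T : Equiv.Perm F := (Equiv.mulLeft₀ α hα).trans (Equiv.subRight c)
  have hT : ∀ v : N, T * τ (Multiplicative.ofAdd v) * T⁻¹ = τ (Multiplicative.ofAdd (θ v)) := by
    intro v
    rw [mul_inv_eq_iff_eq_mul]
    ext y
    simp [T, τ, hφ]
    ring
  have hcomp : ∀ g, τ.comp ((zpowersHom (MulAut (Multiplicative N))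
      (AddEquiv.toMultiplicative θ)) g).toMonoidHom =
      (MulAut.conj ((zpowersHom (Equiv.Perm F) T) g)).toMonoidHom.comp τ := by
    have key : ∀ (k : ℤ) (v : Multiplicative N),
        τ (((AddEquiv.toMultiplicative θ : MulAut (Multiplicative N)) ^ k) v) =
          T ^ k * τ v * (T ^ k)⁻¹ := by
      set A : MulAut (Multiplicative N) := AddEquiv.toMultiplicative θ with hA
      have hT' : ∀ v, τ (A v) = T * τ v * T⁻¹ := fun v => (hT v.toAdd).symm
      have hT'' : ∀ v, τ (A⁻¹ v) = T⁻¹ * τ v * T := fun v => by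
        have := hT' (A⁻¹ v)
        rw [MulAut.apply_inv_self] at this
        rw [this]; group
      intro k
      induction k using Int.induction_on with
      | zero => intro v; simp
      | succ k ih => intro v; rw [zpow_add_one, MulAut.mul_apply, ih, hT']; group
      | pred k ih => intro v; rw [zpow_sub_one, MulAut.mul_apply, ih, hT'']; group
    intro g
    exact MonoidHom.ext fun v => key g.toAdd v
  refine ⟨SemidirectProduct.lift τ (zpowersHom _ T) hcomp, fun v y => ?_, fun y => ?_⟩
  · rw [emb, SemidirectProduct.lift_inl]; rfl
  · rw [gen, SemidirectProduct.lift_inr]; simp [T]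

theorem exists_subgroup_of_eigenfunctional {F : Type*} [Field F] (φ : N →+ F) (α c : F)
    (hα : α ≠ 0) (hφ : ∀ v, φ (θ v) = α * φ v) (hs : Function.Surjective φ) :
    ∃ H : Subgroup (abelianByZ N θ), (∀ v, emb θ v ∈ H ↔ φ v = 0) ∧
      (∀ v, emb θ v * gen θ ∈ H ↔ φ v = c) ∧ H.index = Nat.card F := by
  obtain ⟨ρ, h1, h2⟩ := exists_affine_hom θ φ α c hα hφ
  let := MulAction.compHom F ρ
  have hsmul : ∀ (g : abelianByZ N θ) (y : F), g • y = ρ g y := fun _ _ => rfl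
  refine ⟨MulAction.stabilizer _ (0 : F), fun v => ?_, fun v => ?_, ?_⟩
  · rw [MulAction.mem_stabilizer_iff, hsmul, h1, zero_add]
  · rw [MulAction.mem_stabilizer_iff, hsmul, map_mul, Equiv.Perm.mul_apply, h1, h2]
    constructor <;> intro h <;> linear_combination h
  · rw [MulAction.index_stabilizer]
    have : MulAction.orbit (abelianByZ N θ) (0 : F) = Set.univ := by
      refine Set.eq_univ_of_forall fun y => ?_
      obtain ⟨v, rfl⟩ := hs y
      exact ⟨emb θ v, by simp [hsmul, h1]⟩
    rw [this, Set.ncard_univ]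

theorem exists_eigenfunctional_of_isCoatom {H : Subgroup (abelianByZ N θ)} (hH : IsCoatom H)
    (hi : H.index ≠ 0) (hN : ¬ ∀ v, emb θ v ∈ H) :
    ∃ (F : Type) (_ : Field F) (φ : N →+ F) (α c : F), Nat.card F = H.index ∧
      Function.Surjective φ ∧ (∀ v, φ (θ v) = α * φ v) ∧ (∀ v, emb θ v ∈ H ↔ φ v = 0) ∧
      (∀ v, emb θ v * gen θ ∈ H ↔ φ v = c) := by
  obtain ⟨v₀, hv₀⟩ : ∃ v₀, emb θ v₀ * gen θ ∈ H := by
    have hlt : H ⊔ (SemidirectProduct.inl : Multiplicative N →* abelianByZ N θ).range = ⊤ := by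
      refine hH.2 _ (lt_of_le_of_ne le_sup_left fun h => hN fun v => ?_)
      rw [h]
      exact (le_sup_right : _ ≤ H ⊔ _) ⟨Multiplicative.ofAdd v, rfl⟩
    have hmem : gen θ ∈ (SemidirectProduct.inl : Multiplicative N →* abelianByZ N θ).range ⊔ H := by
      rw [sup_comm, hlt]; trivial
    have : (SemidirectProduct.inl : Multiplicative N →* abelianByZ N θ).range.Normal := by
      rw [SemidirectProduct.range_inl_eq_ker_rightHom]; infer_instance
    obtain ⟨_, ⟨v, rfl⟩, h, hh, hvh⟩ := Subgroup.mem_sup_of_normal_left.mp hmem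
    refine ⟨-v.toAdd, ?_⟩
    rw [← hvh, emb_neg]
    simpa [emb] using hh
  have hconj : ∀ v, (emb θ v₀ * gen θ) * emb θ v * (emb θ v₀ * gen θ)⁻¹ = emb θ (θ v) := by
    intro v
    have h1 : (emb θ v₀ * gen θ) * emb θ v * (emb θ v₀ * gen θ)⁻¹ =
      emb θ v₀ * (gen θ * emb θ v * (gen θ)⁻¹) * (emb θ v₀)⁻¹ := by group
    rw [h1, gen_conj_emb, ← emb_add, ← emb_sub, add_sub_cancel_left]
  have hHθ : ∀ v, emb θ v ∈ H ↔ emb θ (θ v) ∈ H := by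
    intro v
    rw [← hconj, H.mul_mem_cancel_right (H.inv_mem hv₀), H.mul_mem_cancel_left hv₀]
  let K : AddSubgroup N :=
    { carrier := {v | emb θ v ∈ H}
      zero_mem' := by simp [emb_zero, H.one_mem]
      add_mem' := fun {v w} hv hw => by
        simp only [Set.mem_ofPred_eq, emb_add] at *; exact H.mul_mem hv hw
      neg_mem' := fun {v} hv => by
        simp only [Set.mem_ofPred_eq, emb_neg] at *; exact H.inv_mem hv }
  have hK : ∀ v, v ∈ K ↔ emb θ v ∈ H := fun v => Iff.rfl
  have hcard : Nat.card (N ⧸ K) = H.index := by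
    refine Nat.card_eq_of_bijective
      (fun q : N ⧸ K => Quotient.liftOn' q (fun v => (emb θ v : abelianByZ N θ ⧸ H))
        fun v w hvw => ?_) ⟨?_, ?_⟩
    · rw [QuotientAddGroup.leftRel_apply] at hvw
      rw [QuotientGroup.eq, ← emb_neg, ← emb_add]
      exact hvw
    · intro x y
      induction x using QuotientAddGroup.induction_on with | H v => ?_
      induction y using QuotientAddGroup.induction_on with | H w => ?_
      intro hvw
      have hvw' : (emb θ v : abelianByZ N θ ⧸ H) = emb θ w := hvw
      rw [QuotientGroup.eq, ← emb_neg, ← emb_add] at hvw'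
      exact QuotientAddGroup.eq.mpr hvw'
    · intro x
      induction x using QuotientGroup.induction_on with | H g => ?_
      obtain ⟨v, k, rfl⟩ := exists_eq_emb_mul_zpow θ v₀ g
      exact ⟨(v : N ⧸ K), (QuotientGroup.mk_mul_of_mem _ (H.zpow_mem hv₀ k)).symm⟩
  have hKfin : K.index ≠ 0 := by rw [AddSubgroup.index, hcard]; exact hi
  let Θ : N →ₗ[ℤ] N := θ.toAddMonoidHom.toIntLinearMap
  let KZ : Submodule ℤ N := K.toIntSubmodule
  let Θ' : (N ⧸ KZ) →ₗ[ℤ] (N ⧸ KZ) := KZ.mapQ KZ Θ fun v hv => (hHθ v).mp hv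
  have hX : ∀ v, (X : ℤ[X]) • Module.AEval'.of Θ' (KZ.mkQ v) = Module.AEval'.of Θ' (KZ.mkQ (θ v)) :=
    fun v => by rw [Module.AEval'.X_smul_of]; rfl
  have hsimple : IsSimpleModule ℤ[X] (Module.AEval' Θ') := by
    have hnt : Nontrivial (Module.AEval' Θ') := by
      obtain ⟨v, hv⟩ := not_forall.mp hN
      refine ⟨Module.AEval'.of Θ' (KZ.mkQ v), 0, fun h => hv ?_⟩
      rw [LinearEquiv.map_eq_zero_iff, Submodule.mkQ_apply, Submodule.Quotient.mk_eq_zero] at h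
      exact h
    refine (isSimpleModule_iff ..).mpr ⟨fun P => or_iff_not_imp_left.mpr fun hP => ?_⟩
    let L : AddSubgroup N := P.toAddSubgroup.comap
      (((Module.AEval'.of Θ').toLinearMap ∘ₗ KZ.mkQ).toAddMonoidHom)
    have hL : ∀ v, v ∈ L ↔ Module.AEval'.of Θ' (KZ.mkQ v) ∈ P := fun v => Iff.rfl
    have hKL : K ≤ L := fun v hv => by
      rw [hL, Submodule.mkQ_apply, (Submodule.Quotient.mk_eq_zero KZ).mpr hv, map_zero]
      exact P.zero_mem
    have hLθ : L ≤ L.comap θ.toAddMonoidHom := fun v hv => by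
      rw [AddSubgroup.mem_comap]
      change θ v ∈ L
      rw [hL, ← hX]
      exact P.smul_mem _ hv
    have hLθ' : L.comap θ.toAddMonoidHom ≤ L := by
      have h1 := AddSubgroup.relIndex_mul_index hLθ
      rw [AddSubgroup.index_comap_of_surjective L (f := θ.toAddMonoidHom) θ.surjective] at h1
      have h2 : L.index ≠ 0 := fun h => hKfin (by
        rw [← AddSubgroup.relIndex_mul_index hKL, h, mul_zero])
      exact AddSubgroup.relIndex_eq_one.mp (mul_right_cancel₀ h2 (h1.trans (one_mul _).symm))
    have hLiff : ∀ v, v ∈ L ↔ θ v ∈ L := fun v => ⟨fun h => hLθ h, fun h => hLθ' h⟩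
    let L' : Subgroup (abelianByZ N θ) := (AddSubgroup.toSubgroup L).map SemidirectProduct.inl
    have hL' : ∀ v, emb θ v ∈ L' ↔ v ∈ L := by
      intro v
      constructor
      · rintro ⟨w, hw, hwv⟩
        have := SemidirectProduct.inl_injective hwv
        subst this
        exact hw
      · exact fun h => ⟨_, h, rfl⟩
    have hL'' : ∀ g ∈ L', ∃ v ∈ L, g = emb θ v := by
      rintro _ ⟨w, hw, rfl⟩
      exact ⟨w.toAdd, hw, rfl⟩
    have hnormal : L'.Normal := by
      rw [← Subgroup.normalizer_eq_top_iff, eq_top_iff]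
      have hgen : gen θ ∈ Subgroup.normalizer (L' : Set (abelianByZ N θ)) := by
        rw [Subgroup.mem_normalizer_iff]
        intro h
        constructor
        · intro hh
          obtain ⟨v, hv, rfl⟩ := hL'' h hh
          rw [gen_conj_emb, hL', ← hLiff]
          exact hv
        · intro hh
          obtain ⟨v, hv, hvh⟩ := hL'' _ hh
          obtain ⟨w, rfl⟩ := θ.surjective v
          rw [← gen_conj_emb, mul_left_inj, mul_right_inj] at hvh
          rw [hvh, hL', hLiff]
          exact hv
      have hemb : ∀ v, emb θ v ∈ Subgroup.normalizer (L' : Set (abelianByZ N θ)) := by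
        intro v
        have hcomm : ∀ w, emb θ v * emb θ w * (emb θ v)⁻¹ = emb θ w := fun w => by
          rw [← emb_add, ← emb_sub, add_sub_cancel_left]
        rw [Subgroup.mem_normalizer_iff]
        intro h
        constructor
        · intro hh
          obtain ⟨w, hw, rfl⟩ := hL'' h hh
          rwa [hcomm]
        · intro hh
          obtain ⟨w, hw, hwh⟩ := hL'' _ hh
          rw [← hcomm w, mul_left_inj, mul_right_inj] at hwh
          rw [hwh, hL']
          exact hw
      intro g _
      obtain ⟨v, k, rfl⟩ := exists_eq_emb_mul_gen_zpow θ g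
      exact mul_mem (hemb v) (zpow_mem hgen k)
    have htop : H ⊔ L' = ⊤ := by
      refine hH.2 _ (lt_of_le_of_ne le_sup_left fun h => hP ?_)
      rw [eq_bot_iff]
      intro x hx
      obtain ⟨y, rfl⟩ := (Module.AEval'.of Θ').surjective x
      obtain ⟨v, rfl⟩ := KZ.mkQ_surjective y
      have h1 : emb θ v ∈ H := by
        rw [h]
        exact (le_sup_right : L' ≤ H ⊔ L') ((hL' v).mpr hx)
      rw [Submodule.mkQ_apply, (Submodule.Quotient.mk_eq_zero KZ).mpr h1, map_zero]
      exact zero_mem _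
    rw [eq_top_iff]
    intro x _
    obtain ⟨y, rfl⟩ := (Module.AEval'.of Θ').surjective x
    obtain ⟨v, rfl⟩ := KZ.mkQ_surjective y
    have hv : emb θ v ∈ H ⊔ L' := by rw [htop]; trivial
    obtain ⟨h, hh, l, hl, hlv⟩ := Subgroup.mem_sup_of_normal_right.mp hv
    obtain ⟨w, hw, rfl⟩ := hL'' l hl
    rw [← eq_mul_inv_iff_mul_eq, ← emb_sub] at hlv
    have := L.add_mem (hKL (show v - w ∈ K by rw [hK, ← hlv]; exact hh)) hw
    rwa [sub_add_cancel] at this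
  obtain ⟨I, hI, ⟨e⟩⟩ := isSimpleModule_iff_quot_maximal.mp hsimple
  have he : ∀ x : Module.AEval' Θ', e ((X : ℤ[X]) • x) = Ideal.Quotient.mk I X * e x := by
    intro x
    obtain ⟨f, hf⟩ := Ideal.Quotient.mk_surjective (e x)
    rw [map_smul, ← hf, ← map_mul]; rfl
  let φ : N →+ ℤ[X] ⧸ I := (e.toLinearMap.toAddMonoidHom.comp
    (Module.AEval'.of Θ').toLinearMap.toAddMonoidHom).comp KZ.mkQ.toAddMonoidHom
  have hφ : ∀ v, φ v = e (Module.AEval'.of Θ' (KZ.mkQ v)) := fun _ => rfl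
  have hφH : ∀ v, emb θ v ∈ H ↔ φ v = 0 := fun v => by
    rw [hφ, LinearEquiv.map_eq_zero_iff, LinearEquiv.map_eq_zero_iff, Submodule.mkQ_apply,
      Submodule.Quotient.mk_eq_zero]
    rfl
  refine ⟨ℤ[X] ⧸ I, Ideal.Quotient.field I, φ, Ideal.Quotient.mk I X, φ v₀, ?_, ?_, ?_, hφH, ?_⟩
  · rw [← hcard]
    exact (Nat.card_congr ((Module.AEval'.of Θ').toEquiv.trans e.toEquiv)).symm
  · exact e.surjective.comp ((Module.AEval'.of Θ').surjective.comp KZ.mkQ_surjective)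
  · intro v
    rw [hφ, hφ, ← he, hX]
  · intro v
    have h1 : emb θ v * gen θ = emb θ (v - v₀) * (emb θ v₀ * gen θ) := by
      rw [emb_sub]; group
    rw [h1, H.mul_mem_cancel_right hv₀, hφH, map_sub]
    exact sub_eq_zero

end abelianByZ

end AbelianByZ

theorem exists_prime_ge_and_root (g : ℤ[X]) (hg : 0 < g.natDegree) (m : ℕ) :
    ∃ p : ℕ, p.Prime ∧ m ≤ p ∧ ∃ r : ZMod p, g.eval₂ (Int.castRingHom (ZMod p)) r = 0 := by
  by_cases hc : g.coeff 0 = 0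
  · obtain ⟨p, hmp, hp⟩ := Nat.exists_infinite_primes m
    exact ⟨p, hp, hmp, 0, by simp [hc]⟩
  set c := g.coeff 0 with hcdef
  set M : ℤ := (m.factorial : ℤ) with hM
  have hM0 : M ≠ 0 := by simp [hM, Nat.factorial_ne_zero]
  set k : ℤ[X] := 1 + C M * X * (g.divX.comp (C (c * M) * X)) with hk
  have hgk : g.comp (C (c * M) * X) = C c * k := by
    conv_lhs => rw [← Polynomial.divX_mul_X_add g]
    simp only [add_comp, mul_comp, X_comp, C_comp, hk, C_mul]
    ring
  have hdeg : 0 < k.natDegree := by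
    have h1 : (g.comp (C (c * M) * X)).natDegree = g.natDegree := by
      rw [natDegree_comp, natDegree_C_mul_X _ (mul_ne_zero hc hM0), mul_one]
    rw [hgk, natDegree_C_mul hc] at h1
    omega
  have hk0 : k ≠ 0 := by rintro h; simp [h] at hdeg
  have hk1 : k - 1 ≠ 0 := by
    intro h
    rw [sub_eq_zero.mp h] at hdeg
    simp at hdeg
  have hk2 : k + 1 ≠ 0 := by
    intro h
    rw [eq_neg_of_add_eq_zero_left h] at hdeg
    simp at hdeg
  obtain ⟨y, hy⟩ : ∃ y, (k * ((k - 1) * (k + 1))).eval y ≠ 0 := by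
    by_contra! h
    exact mul_ne_zero hk0 (mul_ne_zero hk1 hk2) (Polynomial.funext (by simpa using h))
  simp only [eval_mul, eval_sub, eval_add, eval_one, ne_eq, mul_eq_zero, not_or] at hy
  obtain ⟨hy0, hy1, hy2⟩ := hy
  have hne : (k.eval y).natAbs ≠ 1 := by omega
  refine ⟨_, Nat.minFac_prime hne, ?_, ((c * M * y : ℤ) : ZMod _), ?_⟩
  · by_contra! hlt
    have hp := Nat.minFac_prime hne
    have h1 : ((k.eval y).natAbs.minFac : ℤ) ∣ M :=
      Int.natCast_dvd_natCast.mpr ((hp.dvd_factorial).mpr hlt.le)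
    have h2 : ((k.eval y).natAbs.minFac : ℤ) ∣ k.eval y :=
      Int.natCast_dvd.mpr (Nat.minFac_dvd _)
    have h3 : k.eval y = 1 + M * (y * (g.divX.comp (C (c * M) * X)).eval y) := by
      simp only [hk, eval_add, eval_mul, eval_one, eval_C, eval_X]; ring
    have h4 : ((k.eval y).natAbs.minFac : ℤ) ∣ 1 := by
      have := dvd_sub h2 (h1.mul_right (y * (g.divX.comp (C (c * M) * X)).eval y))
      rwa [h3, add_sub_cancel_right, ← h3] at this
    exact hp.one_lt.ne' (by exact_mod_cast Int.eq_one_of_dvd_one (by positivity) h4)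
  · have h := congrArg (Polynomial.eval y) hgk
    simp only [eval_comp, eval_mul, eval_C, eval_X] at h
    rw [Polynomial.eval₂_at_intCast, Int.cast_id, h, map_mul]
    refine mul_eq_zero_of_right _ ?_
    rw [Int.coe_castRingHom, ZMod.intCast_zmod_eq_zero_iff_dvd]
    exact Int.natCast_dvd.mpr (Nat.minFac_dvd _)

theorem exists_int_multiple (f : ℚ[X]) :
    ∃ D : ℤ, D ≠ 0 ∧ ∃ F : ℤ[X], F.map (Int.castRingHom ℚ) = C (D : ℚ) * f := by
  obtain ⟨b, hb, h⟩ := IsLocalization.integerNormalization_spec (nonZeroDivisors ℤ) f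
  refine ⟨b, nonZeroDivisors.ne_zero hb,
    IsLocalization.integerNormalization (nonZeroDivisors ℤ) f, ?_⟩
  rw [← algebraMap_int_eq, h, ← Int.cast_smul_eq_zsmul ℚ, smul_eq_C_mul]

theorem nonempty_closure_ringHom_of_away {B F : Type*} [CommRing B] [Field F] (ι₀ : B →+* ℂ)
    (hι₀ : Function.Injective ι₀) (π₀ : B →+* F) (E : ℤ) (hE : E ≠ 0) (hEF : (E : F) ≠ 0)
    (S : Set ℂ) (hS : ∀ s ∈ S, ∃ x, ι₀ x = E * s) :
    Nonempty (Subring.closure S →+* F) := by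
  have hEC : (E : ℂ) ≠ 0 := by exact_mod_cast hE
  let ι : Localization.Away (E : B) →+* ℂ := IsLocalization.Away.lift (E : B) (g := ι₀)
    (by simpa using hE)
  let π : Localization.Away (E : B) →+* F := IsLocalization.Away.lift (E : B) (g := π₀)
    (by simpa using hEF)
  have hι : Function.Injective ι := by
    have hB : (E : B) ∈ nonZeroDivisors B := by
      refine mem_nonZeroDivisors_of_injective hι₀ ?_
      simpa using hEC
    refine (injective_iff_map_eq_zero ι).mpr fun z hz => ?_
    obtain ⟨⟨x, y⟩, hxy⟩ := IsLocalization.surj (Submonoid.powers (E : B)) z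
    have h1 := congrArg ι hxy
    simp only [map_mul, hz, zero_mul, ι, IsLocalization.Away.lift_eq] at h1
    have hx : x = 0 := hι₀ (by rw [← h1, map_zero])
    simp only [hx, map_zero] at hxy
    exact (IsLocalization.map_units _ y).mul_left_eq_zero.mp hxy
  have hle : Subring.closure S ≤ ι.range := by
    rw [Subring.closure_le]
    intro s hs
    obtain ⟨x, hx⟩ := hS s hs
    refine ⟨IsLocalization.mk' _ x ⟨(E : B), Submonoid.mem_powers _⟩, ?_⟩
    apply mul_left_cancel₀ hEC
    rw [← hx]
    have h1 := congrArg ι (IsLocalization.mk'_spec' (Localization.Away (E : B)) x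
      (⟨(E : B), Submonoid.mem_powers _⟩ : Submonoid.powers (E : B)))
    simpa [ι, IsLocalization.Away.lift_eq] using h1
  exact ⟨(π.comp (RingEquiv.ofLeftInverse (f := ι)
    (Function.leftInverse_invFun hι)).symm.toRingHom).comp (Subring.inclusion hle)⟩

theorem exists_prime_ge_and_ringHom (S : Finset ℂ) (hS : ∀ s ∈ S, IsAlgebraic ℚ s) (m : ℕ) :
    ∃ p : ℕ, p.Prime ∧ m ≤ p ∧ Nonempty (Subring.closure (S : Set ℂ) →+* ZMod p) := by
  have hfd : FiniteDimensional ℚ (IntermediateField.adjoin ℚ (S : Set ℂ)) :=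
    IntermediateField.finiteDimensional_adjoin fun s hs => (hS s hs).isIntegral
  obtain ⟨γ₀, hγ₀⟩ := Field.exists_primitive_element ℚ (IntermediateField.adjoin ℚ (S : Set ℂ))
  have hγ₀Z : IsAlgebraic ℤ γ₀ := by
    rw [IsFractionRing.isAlgebraic_iff ℤ ℚ]
    exact Algebra.IsAlgebraic.isAlgebraic γ₀
  obtain ⟨e, he0, hγint⟩ := hγ₀Z.exists_integral_multiple
  set γ : ℂ := e * algebraMap _ ℂ γ₀ with hγ
  have he : (e : ℂ) ≠ 0 := by exact_mod_cast he0
  have hγI : IsIntegral ℤ γ := by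
    have := hγint.map (IntermediateField.val _ |>.restrictScalars ℤ)
    simpa [hγ] using this
  have hrep : ∀ s ∈ S, ∃ D : ℤ, D ≠ 0 ∧ ∃ F : ℤ[X], aeval γ F = D * s := by
    intro s hs
    have hs' : s ∈ IntermediateField.adjoin ℚ (S : Set ℂ) := IntermediateField.subset_adjoin _ _ hs
    have h1 : (⟨s, hs'⟩ : IntermediateField.adjoin ℚ (S : Set ℂ)) ∈ Algebra.adjoin ℚ {γ₀} := by
      have h2 := IntermediateField.adjoin_simple_toSubalgebra_of_isAlgebraic (F := ℚ)
        (Algebra.IsAlgebraic.isAlgebraic γ₀)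
      rw [← h2, hγ₀]; trivial
    rw [Algebra.adjoin_singleton_eq_range_aeval] at h1
    obtain ⟨f, hf⟩ := h1
    obtain ⟨D, hD, F, hF⟩ := exists_int_multiple (f.comp (C ((e : ℚ)⁻¹) * X))
    refine ⟨D, hD, F, ?_⟩
    have h3 : aeval γ F = aeval γ (F.map (Int.castRingHom ℚ)) := by
      rw [← algebraMap_int_eq, aeval_map_algebraMap]
    have h4 : aeval (algebraMap _ ℂ γ₀) f = s := by
      rw [aeval_algebraMap_apply]
      exact congrArg Subtype.val hf
    have h5 : aeval γ (C (e : ℚ)⁻¹ * X) = algebraMap _ ℂ γ₀ := by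
      rw [map_mul, aeval_C, aeval_X, hγ]
      simp [he]
    rw [h3, hF, map_mul, aeval_C, aeval_comp, h5, h4]
    simp
  choose! D hD F hF using hrep
  set E : ℤ := ∏ s ∈ S, D s with hE
  have hE0 : E ≠ 0 := Finset.prod_ne_zero_iff.mpr hD
  obtain ⟨p, hp, hmp, r, hr⟩ := exists_prime_ge_and_root (minpoly ℤ γ) (minpoly.natDegree_pos hγI)
    (max m (E.natAbs + 1))
  have := Fact.mk hp
  refine ⟨p, hp, (le_max_left _ _).trans hmp, ?_⟩
  have hγ0 : (minpoly ℤ γ).eval₂ (Int.castRingHom ℂ) γ = 0 := minpoly.aeval ℤ γ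
  have hlift : ∀ f : ℤ[X], AdjoinRoot.lift (Int.castRingHom ℂ) γ hγ0
      (AdjoinRoot.mk _ f) = aeval γ f := fun f => by rw [AdjoinRoot.lift_mk]; rfl
  refine nonempty_closure_ringHom_of_away
    (AdjoinRoot.lift (Int.castRingHom ℂ) γ hγ0) ?_
    (AdjoinRoot.lift (Int.castRingHom _) r hr) E hE0 ?_ S ?_
  · refine (injective_iff_map_eq_zero _).mpr fun z hz => ?_
    induction z using AdjoinRoot.induction_on with
    | ih f =>
      rw [hlift] at hz
      exact AdjoinRoot.mk_eq_zero.mpr (minpoly.isIntegrallyClosed_dvd hγI hz)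
  · rw [ne_eq, ZMod.intCast_zmod_eq_zero_iff_dvd]
    intro h
    have := Nat.le_of_dvd (Int.natAbs_pos.mpr hE0) (Int.natCast_dvd.mp h)
    have := (le_max_right _ _).trans hmp
    omega
  · intro s hs
    obtain ⟨c, hc⟩ := Finset.dvd_prod_of_mem D hs
    refine ⟨AdjoinRoot.mk _ (C c * F s), ?_⟩
    rw [hlift, map_mul, hF s hs, hE, hc, aeval_C]
    simp
    ring

/-- A finitely generated abelian group with an automorphism whose rationalization is a direct sum of
cyclic modules admits a compatible map to that sum with torsion kernel and cokernel. -/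
theorem exists_rationalization {N : Type*} [AddCommGroup N] [AddGroup.FG N] (θ : N ≃+ N)
    {d : ℕ} (a : Fin d → ℚ[X])
    (hiso : Nonempty
      ((Module.AEval' (LinearMap.baseChange ℚ θ.toAddMonoidHom.toIntLinearMap)) ≃ₗ[ℚ[X]]
        ((j : Fin d) → ℚ[X] ⧸ Ideal.span {a j}))) :
    (∀ j, a j ≠ 0) ∧
    ∃ ι : N →+ ((j : Fin d) → ℚ[X] ⧸ Ideal.span {a j}),
      (∀ v, ι (θ v) = (X : ℚ[X]) • ι v) ∧
      (∀ v, ι v = 0 → ∃ D : ℤ, D ≠ 0 ∧ D • v = 0) ∧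
      (∀ x, ∃ D : ℤ, D ≠ 0 ∧ ∃ v, ι v = D • x) := by
  obtain ⟨e⟩ := hiso
  set Φ := LinearMap.baseChange ℚ θ.toAddMonoidHom.toIntLinearMap with hΦ
  have hfin : Module.Finite ℤ N := Module.Finite.iff_addGroup_fg.mpr inferInstance
  have hloc : IsLocalizedModule (nonZeroDivisors ℤ) (TensorProduct.mk ℤ ℚ N 1) :=
    (isLocalizedModule_iff_isBaseChange (nonZeroDivisors ℤ) ℚ _).mpr
      (TensorProduct.isBaseChange ℤ N ℚ)
  refine ⟨fun j hj => ?_, ?_⟩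
  · have h1 : ∀ x : Module.AEval' Φ, Φ.charpoly • x = 0 := by
      intro x
      obtain ⟨y, rfl⟩ := (Module.AEval'.of Φ).surjective x
      rw [← Module.AEval.of_aeval_smul]
      simp [LinearMap.aeval_self_charpoly]
    have h2 := congrArg e (h1 (e.symm (Pi.single j 1)))
    rw [map_smul, e.apply_symm_apply, map_zero] at h2
    have h3 := congrFun h2 j
    rw [Pi.smul_apply, Pi.single_eq_same, ← map_one (Ideal.Quotient.mk _),
      ← Ideal.Quotient.mk_eq_mk,
      ← Submodule.Quotient.mk_smul, Pi.zero_apply, Submodule.Quotient.mk_eq_zero, smul_eq_mul,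
      mul_one, hj, Ideal.mem_span_singleton, zero_dvd_iff] at h3
    exact (LinearMap.charpoly_monic Φ).ne_zero h3
  · refine ⟨(e.toLinearMap.toAddMonoidHom.comp (Module.AEval'.of Φ).toLinearMap.toAddMonoidHom).comp
      (TensorProduct.mk ℤ ℚ N 1).toAddMonoidHom, ?_, ?_, ?_⟩
    · intro v
      have : Module.AEval'.of Φ ((1 : ℚ) ⊗ₜ[ℤ] θ v) =
          (X : ℚ[X]) • Module.AEval'.of Φ ((1 : ℚ) ⊗ₜ[ℤ] v) := by
        rw [Module.AEval'.X_smul_of, hΦ, LinearMap.baseChange_tmul]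
        rfl
      simp [this]
    · intro v hv
      have h0 : TensorProduct.mk ℤ ℚ N 1 v = 0 := by simpa using hv
      obtain ⟨D, hD⟩ := (IsLocalizedModule.eq_zero_iff (nonZeroDivisors ℤ) _).mp h0
      exact ⟨D, nonZeroDivisors.coe_ne_zero D, hD⟩
    · intro x
      obtain ⟨⟨v, D⟩, hD⟩ := IsLocalizedModule.surj (nonZeroDivisors ℤ) (TensorProduct.mk ℤ ℚ N 1)
        ((Module.AEval'.of Φ).symm (e.symm x))
      refine ⟨D, nonZeroDivisors.coe_ne_zero D, v, ?_⟩
      simp only [LinearMap.toAddMonoidHom_coe, AddMonoidHom.comp_apply]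
      have hD' : (D : ℤ) • ((Module.AEval'.of Φ).symm (e.symm x)) =
          (TensorProduct.mk ℤ ℚ N 1) v := hD
      rw [← hD']
      simp

theorem map_aeval_eq_smul {N W : Type*} [AddCommGroup N] [AddCommGroup W] [Module ℚ[X] W]
    (Θ : N →ₗ[ℤ] N) (ι : N →+ W) (hι : ∀ v, ι (Θ v) = (X : ℚ[X]) • ι v) (f : ℤ[X]) (v : N) :
    ι (aeval Θ f v) = f.map (Int.castRingHom ℚ) • ι v := by
  induction f using Polynomial.induction_on' with
  | add p q hp hq => simp [hp, hq, add_smul]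
  | monomial n c =>
    have h1 : ∀ n, ι ((Θ ^ n) v) = (X ^ n : ℚ[X]) • ι v := by
      intro n
      induction n with
      | zero => simp
      | succ n ih => rw [pow_succ', Module.End.mul_apply, hι, ih, smul_smul, pow_succ']
    rw [aeval_monomial, Module.End.mul_apply, Module.algebraMap_end_apply, map_zsmul, h1,
      Polynomial.map_monomial, ← C_mul_X_pow_eq_monomial, mul_smul, ← Int.cast_smul_eq_zsmul ℚ[X]]
    simp

theorem map_aeval_eq_mul {N F : Type*} [AddCommGroup N] [CommRing F]
    (Θ : N →ₗ[ℤ] N) (φ : N →+ F) (α : F) (hφ : ∀ v, φ (Θ v) = α * φ v) (f : ℤ[X]) (v : N) :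
    φ (aeval Θ f v) = aeval α f * φ v := by
  induction f using Polynomial.induction_on' with
  | add p q hp hq => simp [hp, hq, add_mul]
  | monomial n c =>
    have h1 : ∀ n, φ ((Θ ^ n) v) = α ^ n * φ v := by
      intro n
      induction n with
      | zero => simp
      | succ n ih => rw [pow_succ', Module.End.mul_apply, hφ, ih, pow_succ', mul_assoc]
    rw [aeval_monomial, Module.End.mul_apply, Module.algebraMap_end_apply, map_zsmul, h1,
      aeval_monomial]
    simp [mul_assoc]

theorem smul_single_one_eq {d : ℕ} (a : Fin d → ℚ[X]) (f : ℚ[X]) (j : Fin d) :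
    f • (Pi.single j 1 : (j : Fin d) → ℚ[X] ⧸ Ideal.span {a j}) =
      Pi.single j (Ideal.Quotient.mk _ f) := by
  have h : f • (1 : ℚ[X] ⧸ Ideal.span {a j}) = Ideal.Quotient.mk _ f := by
    rw [← map_one (Ideal.Quotient.mk _), ← Ideal.Quotient.mk_eq_mk, ← Submodule.Quotient.mk_smul,
      smul_eq_mul, mul_one, Ideal.Quotient.mk_eq_mk]
  rw [← h]
  funext i
  by_cases hij : i = j
  · subst hij; simp
  · simp [Pi.single_eq_of_ne hij]

theorem exists_cyclic_generators {N : Type*} [AddCommGroup N] [AddGroup.FG N] (Θ : N →ₗ[ℤ] N)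
    {d : ℕ} (a : Fin d → ℚ[X])
    (ι : N →+ ((j : Fin d) → ℚ[X] ⧸ Ideal.span {a j}))
    (hι : ∀ v, ι (Θ v) = (X : ℚ[X]) • ι v)
    (hker : ∀ v, ι v = 0 → ∃ D : ℤ, D ≠ 0 ∧ D • v = 0)
    (hcoker : ∀ x, ∃ D : ℤ, D ≠ 0 ∧ ∃ v, ι v = D • x) :
    ∃ (u : Fin d → N) (b : Fin d → ℤ[X]) (δ : Fin d → ℤ) (E : ℤ), E ≠ 0 ∧ (∀ j, δ j ≠ 0) ∧
      (∀ j, ∃ β : ℤ, β ≠ 0 ∧ (b j).map (Int.castRingHom ℚ) = C (β : ℚ) * a j) ∧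
      (∀ j, aeval Θ (b j) (u j) = 0) ∧
      (∀ j, ι (u j) = δ j • Pi.single j 1) ∧
      (∀ v, ∃ c : Fin d → ℤ[X], E • v = ∑ j, aeval Θ (c j) (u j)) := by
  choose D hD w hw using fun j => hcoker (Pi.single j 1)
  choose β hβ b hb using fun j => exists_int_multiple (a j)
  have hbw : ∀ j, ι (aeval Θ (b j) (w j)) = 0 := by
    intro j
    rw [map_aeval_eq_smul Θ ι hι, hw, smul_comm, hb, smul_single_one_eq,
      Ideal.Quotient.eq_zero_iff_mem.mpr
        (Ideal.mul_mem_left _ _ (Ideal.mem_span_singleton_self _))]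
    simp
  choose t ht htw using fun j => hker _ (hbw j)
  set u : Fin d → N := fun j => t j • w j with hu
  set δ : Fin d → ℤ := fun j => t j * D j with hδ
  have hδ0 : ∀ j, δ j ≠ 0 := fun j => mul_ne_zero (ht j) (hD j)
  have hιu : ∀ j, ι (u j) = δ j • Pi.single j 1 := fun j => by
    rw [hu, hδ]; simp only [map_zsmul, hw, mul_smul]
  let L : AddSubgroup N :=
    { carrier := {v | ∃ c : Fin d → ℤ[X], v = ∑ j, aeval Θ (c j) (u j)}
      zero_mem' := ⟨0, by simp⟩
      add_mem' := by
        rintro _ _ ⟨c, rfl⟩ ⟨c', rfl⟩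
        exact ⟨c + c', by simp [Finset.sum_add_distrib]⟩
      neg_mem' := by
        rintro _ ⟨c, rfl⟩
        exact ⟨-c, by simp⟩ }
  have htors : ∀ v, ∃ E : ℤ, E ≠ 0 ∧ E • v ∈ L := by
    intro v
    have hsurj : ∀ j, ∃ f : ℚ[X], Ideal.Quotient.mk (Ideal.span {a j}) f = ι v j :=
      fun j => Ideal.Quotient.mk_surjective _
    choose f hf using hsurj
    choose e he c hc using fun j => exists_int_multiple (f j)
    have hsum : ι v = ∑ j, f j • Pi.single j (1 : ℚ[X] ⧸ Ideal.span {a j}) := by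
      funext i
      rw [Finset.sum_apply, Finset.sum_eq_single i]
      · rw [smul_single_one_eq, Pi.single_eq_same, hf]
      · intro j _ hj
        rw [smul_single_one_eq, Pi.single_eq_of_ne (Ne.symm hj)]
      · simp
    set P : ℤ := ∏ j, (e j * δ j) with hP
    have hP0 : P ≠ 0 := Finset.prod_ne_zero_iff.mpr fun j _ => mul_ne_zero (he j) (hδ0 j)
    have hq : ∀ j, ∃ q, P = e j * δ j * q := fun j => Finset.dvd_prod_of_mem _ (Finset.mem_univ j)
    choose q hq using hq
    have h0 : ι (P • v - ∑ j, aeval Θ (C (q j) * c j) (u j)) = 0 := by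
      rw [map_sub, map_zsmul, hsum, map_sum, Finset.smul_sum, ← Finset.sum_sub_distrib]
      refine Finset.sum_eq_zero fun j _ => ?_
      rw [map_aeval_eq_smul Θ ι hι, hιu, sub_eq_zero, Polynomial.map_mul, hc, map_C,
        ← Int.cast_smul_eq_zsmul ℚ[X], ← Int.cast_smul_eq_zsmul ℚ[X] (δ j), smul_smul, smul_smul]
      congr 1
      rw [hq j]
      simp
      ring
    obtain ⟨T, hT, hTv⟩ := hker _ h0
    refine ⟨T * P, mul_ne_zero hT hP0, fun j => C T * (C (q j) * c j), ?_⟩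
    rw [smul_sub, sub_eq_zero] at hTv
    rw [mul_smul, hTv, Finset.smul_sum]
    refine Finset.sum_congr rfl fun j _ => ?_
    rw [map_mul (aeval Θ) (C T), aeval_C, Module.End.mul_apply, Module.algebraMap_end_apply]
  have hfin : Module.Finite ℤ N := Module.Finite.iff_addGroup_fg.mpr inferInstance
  have hQ : Finite (N ⧸ L.toIntSubmodule) := by
    refine Module.finite_of_fg_torsion _ fun x => ?_
    obtain ⟨v, rfl⟩ := Submodule.Quotient.mk_surjective _ x
    obtain ⟨E, hE, hEv⟩ := htors v
    exact ⟨⟨E, mem_nonZeroDivisors_of_ne_zero hE⟩, (Submodule.Quotient.mk_eq_zero _).mpr hEv⟩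
  refine ⟨u, b, δ, Nat.card (N ⧸ L.toIntSubmodule), by simpa using Nat.card_pos.ne', hδ0,
    fun j => ⟨β j, hβ j, hb j⟩, fun j => ?_, hιu, fun v => ?_⟩
  · rw [hu]; simp only [map_zsmul, htw]
  · have h1 : (Nat.card (N ⧸ L.toIntSubmodule) : ℤ) • v ∈ L.toIntSubmodule := by
      rw [← Submodule.Quotient.mk_eq_zero, Submodule.Quotient.mk_smul]
      simp
    exact h1

theorem exists_natDegree_le_card_roots_dvd_pow {a : ℚ[X]} (ha : a ≠ 0) {b : ℤ[X]} {β : ℤ}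
    (hβ : β ≠ 0) (hb : b.map (Int.castRingHom ℚ) = C (β : ℚ) * a) :
    ∃ s : ℤ[X], s ≠ 0 ∧ s.natDegree ≤ (a.map (algebraMap ℚ ℂ)).roots.toFinset.card ∧
      ∃ D : ℤ, D ≠ 0 ∧ ∃ (k : ℕ) (h : ℤ[X]), C D * s ^ k = b * h := by
  set r := UniqueFactorizationMonoid.radical a with hr
  have hr0 : r ≠ 0 := UniqueFactorizationMonoid.radical_ne_zero
  have hdeg : r.natDegree ≤ (a.map (algebraMap ℚ ℂ)).roots.toFinset.card := by
    have hsep : r.Separable :=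
      PerfectField.separable_iff_squarefree.mpr UniqueFactorizationMonoid.squarefree_radical
    have hsplit := IsAlgClosed.splits (r.map (algebraMap ℚ ℂ))
    rw [← natDegree_map (algebraMap ℚ ℂ), hsplit.natDegree_eq_card_roots,
      ← Multiset.toFinset_card_of_nodup (nodup_roots hsep.map)]
    refine Finset.card_le_card (Multiset.toFinset_subset.mpr (Multiset.subset_of_le ?_))
    exact roots.le_of_dvd ((Polynomial.map_ne_zero_iff (algebraMap ℚ ℂ).injective).mpr ha)
      (Polynomial.map_dvd _ UniqueFactorizationMonoid.radical_dvd_self)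
  obtain ⟨k, q, hq⟩ := UniqueFactorizationMonoid.exists_dvd_radical_self_pow ha
  obtain ⟨D₁, hD₁, S, hS⟩ := exists_int_multiple r
  obtain ⟨D₂, hD₂, Q, hQ⟩ := exists_int_multiple q
  have hinj : Function.Injective (Int.castRingHom ℚ) := RingHom.injective_int _
  have hS0 : S ≠ 0 := by
    rintro rfl
    simp [hr0, hD₁] at hS
  refine ⟨S, hS0, ?_, β * D₂, mul_ne_zero hβ hD₂, k, Q * C (D₁ ^ k), ?_⟩
  · rwa [← natDegree_map_eq_of_injective hinj, hS, natDegree_C_mul (by exact_mod_cast hD₁)]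
  · apply map_injective _ hinj
    rw [← hr] at hq
    simp only [Polynomial.map_mul, Polynomial.map_pow, map_C, hS, hQ, hb,
      eq_intCast (Int.castRingHom ℚ), map_mul, map_pow]
    linear_combination (C (β : ℚ) * C (D₂ : ℚ) * C (D₁ : ℚ) ^ k) * hq

namespace abelianByZ

variable {N : Type*} [AddCommGroup N] (θ : N ≃+ N)

theorem eq_of_forall_emb_mem_of_index_eq {H H' : Subgroup (abelianByZ N θ)}
    (h : ∀ v, emb θ v ∈ H) (h' : ∀ v, emb θ v ∈ H') (hi : H.index = H'.index) : H = H' := by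
  have hcomap : ∀ K : Subgroup (abelianByZ N θ), (∀ v, emb θ v ∈ K) →
      K = (K.comap (SemidirectProduct.inr : Multiplicative ℤ →* abelianByZ N θ)).comap
        SemidirectProduct.rightHom := by
    intro K hK
    ext x
    obtain ⟨v, k, rfl⟩ := exists_eq_emb_mul_gen_zpow θ x
    rw [K.mul_mem_cancel_left (hK v)]
    simp [emb, gen_zpow]
  have hcyc : ∀ P Q : AddSubgroup ℤ, P.index = Q.index → P = Q := by
    intro P Q hPQ
    obtain ⟨m, rfl⟩ := Int.subgroup_cyclic P
    obtain ⟨n, rfl⟩ := Int.subgroup_cyclic Q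
    rw [← AddSubgroup.zmultiples_eq_closure, ← AddSubgroup.zmultiples_eq_closure,
      Int.index_zmultiples, Int.index_zmultiples] at hPQ
    rw [← AddSubgroup.zmultiples_eq_closure, ← AddSubgroup.zmultiples_eq_closure]
    rcases Int.natAbs_eq_natAbs_iff.mp hPQ with rfl | rfl <;> simp
  rw [hcomap H h, hcomap H' h'] at hi ⊢
  rw [Subgroup.index_comap_of_surjective _ SemidirectProduct.rightHom_surjective,
    Subgroup.index_comap_of_surjective _ SemidirectProduct.rightHom_surjective] at hi
  congr 1
  exact Subgroup.toAddSubgroup'.injective (hcyc _ _ hi)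

/-- `H` is the stabilizer of `0` when `N` acts on the field `F` by translations through the
eigenfunctional `φ` with eigenvalue `α` and the generator acts by `y ↦ α * y - c`. -/
structure IsCutOutBy (H : Subgroup (abelianByZ N θ))
    {F : Type*} [Field F] (φ : N →+ F) (α c : F) : Prop where
  surjective : Function.Surjective φ
  map_eq : ∀ v, φ (θ v) = α * φ v
  emb_mem_iff : ∀ v, emb θ v ∈ H ↔ φ v = 0
  emb_mul_gen_mem_iff : ∀ v, emb θ v * gen θ ∈ H ↔ φ v = c

variable {θ} in
theorem IsCutOutBy.transport {H : Subgroup (abelianByZ N θ)} {F F' : Type*} [Field F] [Field F']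
    {φ : N →+ F} {α c : F} (h : IsCutOutBy θ H φ α c) (e : F ≃+* F') :
    IsCutOutBy θ H (e.toAddMonoidHom.comp φ) (e α) (e c) where
  surjective := e.surjective.comp h.surjective
  map_eq v := by simp [h.map_eq]
  emb_mem_iff v := by simp [h.emb_mem_iff]
  emb_mul_gen_mem_iff v := by simp [h.emb_mul_gen_mem_iff]

variable {θ} in
theorem IsCutOutBy.scale {H : Subgroup (abelianByZ N θ)} {F : Type*} [Field F]
    {φ : N →+ F} {α c : F} (h : IsCutOutBy θ H φ α c) {r : F} (hr : r ≠ 0) :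
    IsCutOutBy θ H ((AddMonoidHom.mulLeft r).comp φ) α (r * c) where
  surjective := (mul_left_surjective₀ hr).comp h.surjective
  map_eq v := by simp [h.map_eq]; ring
  emb_mem_iff v := by simp [h.emb_mem_iff, hr]
  emb_mul_gen_mem_iff v := by simp [h.emb_mul_gen_mem_iff, hr]

theorem finite_and_ncard_le_of_isCutOutBy {F : Type*} [Field F] [Finite F] {d : ℕ} (u : Fin d → N)
    (E : ℤ) (hE : (E : F) ≠ 0)
    (hgen : ∀ v, ∃ c : Fin d → ℤ[X],
      E • v = ∑ j, aeval θ.toAddMonoidHom.toIntLinearMap (c j) (u j))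
    (s : Finset (Fin d)) (y₀ : Fin d → F) (R : Finset F) :
    {H : Subgroup (abelianByZ N θ) | ∃ (φ : N →+ F) (α c : F), α ∈ R ∧ (∀ i ∈ s, φ (u i) = y₀ i) ∧
      IsCutOutBy θ H φ α c}.Finite ∧
    {H : Subgroup (abelianByZ N θ) | ∃ (φ : N →+ F) (α c : F), α ∈ R ∧ (∀ i ∈ s, φ (u i) = y₀ i) ∧
      IsCutOutBy θ H φ α c}.ncard ≤ R.card * (Nat.card F ^ (d - s.card) * Nat.card F) := by
  set A := {H : Subgroup (abelianByZ N θ) | ∃ (φ : N →+ F) (α c : F), α ∈ R ∧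
    (∀ i ∈ s, φ (u i) = y₀ i) ∧ IsCutOutBy θ H φ α c} with hA
  choose! φ α c hα hy hcut using fun (H : Subgroup (abelianByZ N θ)) (hH : H ∈ A) => hH
  let f : A → R × ({i // i ∉ s} → F) × F := fun H =>
    (⟨α H, hα H H.2⟩, fun i => φ H (u i), c H)
  have hf : Function.Injective f := by
    rintro ⟨H, hH⟩ ⟨H', hH'⟩ h
    simp only [f, Prod.mk.injEq, Subtype.mk.injEq, funext_iff, Subtype.forall] at h ⊢
    obtain ⟨h1, h2, h3⟩ := h
    have hu : ∀ i, φ H (u i) = φ H' (u i) := fun i => by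
      by_cases hi : i ∈ s
      · rw [hy H hH i hi, hy H' hH' i hi]
      · exact h2 i hi
    have hφ : ∀ v, φ H v = φ H' v := fun v => by
      obtain ⟨p, hp⟩ := hgen v
      refine mul_left_cancel₀ hE ?_
      rw [← zsmul_eq_mul, ← zsmul_eq_mul, ← map_zsmul, ← map_zsmul, hp, map_sum, map_sum]
      refine Finset.sum_congr rfl fun j _ => ?_
      rw [map_aeval_eq_mul _ (φ H) (α H) (hcut H hH).map_eq,
        map_aeval_eq_mul _ (φ H') (α H') (hcut H' hH').map_eq, h1, hu]
    obtain ⟨v₀, hv₀⟩ := (hcut H hH).surjective (c H)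
    refine eq_of_mem_iff θ (v₀ := v₀) (fun v => ?_) (((hcut H hH).emb_mul_gen_mem_iff _).mpr hv₀)
      (((hcut H' hH').emb_mul_gen_mem_iff _).mpr (by rw [← hφ, hv₀, h3]))
    rw [(hcut H hH).emb_mem_iff, (hcut H' hH').emb_mem_iff, hφ]
  refine ⟨Finite.of_injective f hf, ?_⟩
  rw [← Nat.card_coe_set_eq]
  refine (Nat.card_le_card_of_injective f hf).trans_eq ?_
  rw [Nat.card_prod, Nat.card_prod, Nat.card_fun, Nat.card_eq_fintype_card (α := R),
    Fintype.card_coe, Nat.card_eq_fintype_card (α := {i // i ∉ s}), Fintype.card_subtype_compl,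
    Fintype.card_coe, Fintype.card_fin]

theorem exists_intCast_ne_zero_of_surjective (N : Type*) [AddCommGroup N] [AddGroup.FG N] {D : ℤ}
    (hD : D ≠ 0) : ∃ n₀ : ℕ, ∀ {F : Type} [Field F] [Finite F] (φ : N →+ F),
      Function.Surjective φ → n₀ ≤ Nat.card F → (D : F) ≠ 0 := by
  have hfin : Module.Finite ℤ N := Module.Finite.iff_addGroup_fg.mpr inferInstance
  let P : Submodule ℤ N := LinearMap.range (LinearMap.lsmul ℤ N D)
  have : Finite (N ⧸ P) := by
    refine Module.finite_of_fg_torsion _ ?_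
    intro x
    obtain ⟨v, rfl⟩ := P.mkQ_surjective x
    refine ⟨⟨D, mem_nonZeroDivisors_of_ne_zero hD⟩, ?_⟩
    exact (Submodule.Quotient.mk_eq_zero P).mpr ⟨v, rfl⟩
  refine ⟨Nat.card (N ⧸ P) + 1, fun {F} _ _ φ hφ hn hDF => ?_⟩
  let ψ : N ⧸ P →ₗ[ℤ] F := P.liftQ φ.toIntLinearMap (by
    rintro _ ⟨v, rfl⟩
    change φ (D • v) = 0
    rw [map_zsmul, zsmul_eq_mul, hDF, zero_mul])
  have hψ : Function.Surjective ψ := fun y => by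
    obtain ⟨v, rfl⟩ := hφ y
    exact ⟨P.mkQ v, by simp [ψ]⟩
  exact absurd (Nat.card_le_card_of_surjective ψ hψ) (by omega)

theorem mem_roots_map_of_isCutOutBy {H : Subgroup (abelianByZ N θ)} {F : Type*} [Field F]
    {φ : N →+ F} {α c : F} (h : IsCutOutBy θ H φ α c) {w : N} (hw : φ w = 1) {s b : ℤ[X]}
    (hb : aeval θ.toAddMonoidHom.toIntLinearMap b w = 0) {D : ℤ} (hD : (D : F) ≠ 0) {k : ℕ}
    {q : ℤ[X]} (hs : C D * s ^ k = b * q) (hs0 : (s.leadingCoeff : F) ≠ 0) :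
    α ∈ (s.map (Int.castRingHom F)).roots := by
  have h1 := map_aeval_eq_mul θ.toAddMonoidHom.toIntLinearMap φ α h.map_eq b w
  rw [hb, map_zero, hw, mul_one] at h1
  have h2 := congrArg (aeval α) hs
  rw [map_mul, map_mul, ← h1, zero_mul, map_pow, aeval_C, mul_eq_zero, algebraMap_int_eq,
    eq_intCast] at h2
  have h3 : s.map (Int.castRingHom F) ≠ 0 := fun h => hs0 (by
    simpa [coeff_map] using congrArg (fun p => coeff p s.natDegree) h)
  rw [mem_roots h3, IsRoot, eval_map, ← algebraMap_int_eq, ← aeval_def]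
  exact eq_zero_of_pow_eq_zero (h2.resolve_left hD)

theorem exists_forall_ge_ncard_isCoatom_le [AddGroup.FG N] {d : ℕ} (hd : 0 < d) (u : Fin d → N)
    (b : Fin d → ℤ[X]) (hb : ∀ j, b j ≠ 0)
    (hu : ∀ j, aeval θ.toAddMonoidHom.toIntLinearMap (b j) (u j) = 0) (E : ℤ) (hE : E ≠ 0)
    (hgen : ∀ v, ∃ c : Fin d → ℤ[X],
      E • v = ∑ j, aeval θ.toAddMonoidHom.toIntLinearMap (c j) (u j))
    (s : ℤ[X]) (hs0 : s ≠ 0) (D : ℤ) (hD : D ≠ 0) (k : ℕ) (q : ℤ[X])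
    (hs : C D * s ^ k = b ⟨0, hd⟩ * q) :
    ∃ n₀ : ℕ, ∀ n, n₀ ≤ n →
      {H : Subgroup (abelianByZ N θ) | IsCoatom H ∧ H.index = n}.Finite ∧
      {H : Subgroup (abelianByZ N θ) | IsCoatom H ∧ H.index = n}.ncard ≤
        1 + s.natDegree * n ^ d + ∑ j, (b j).natDegree * n ^ (d - 1) := by
  obtain ⟨n₀, hn₀⟩ := exists_intCast_ne_zero_of_surjective N (D := E * D * s.leadingCoeff *
    ∏ j, (b j).leadingCoeff) (by simp [hE, hD, hs0, hb, Finset.prod_ne_zero_iff])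
  refine ⟨n₀ + 1, fun n hn => ?_⟩
  set M := {H : Subgroup (abelianByZ N θ) | IsCoatom H ∧ H.index = n} with hM
  set M₁ := {H ∈ M | ∀ v, emb θ v ∈ H} with hM₁
  set M₂ := {H ∈ M | ¬ ∀ v, emb θ v ∈ H} with hM₂
  have hM12 : M = M₁ ∪ M₂ := by
    ext H
    change H ∈ M ↔ (H ∈ M ∧ ∀ v, emb θ v ∈ H) ∨ (H ∈ M ∧ ¬ ∀ v, emb θ v ∈ H)
    tauto
  have hsub : M₁.Subsingleton := fun H hH H' hH' =>
    eq_of_forall_emb_mem_of_index_eq θ hH.2 hH'.2 (hH.1.2.trans hH'.1.2.symm)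
  suffices h : M₂.Finite ∧
      M₂.ncard ≤ s.natDegree * n ^ d + ∑ j, (b j).natDegree * n ^ (d - 1) by
    rw [hM12]
    refine ⟨hsub.finite.union h.1, (Set.ncard_union_le _ _).trans ?_⟩
    have : Finite M₁ := hsub.finite
    have := Set.ncard_le_one_iff_subsingleton.mpr hsub
    omega
  rcases M₂.eq_empty_or_nonempty with he | ⟨H₀, hH₀⟩
  · simp [he]
  obtain ⟨F, hF, φ₀, α₀, c₀, hcard, hsurj, -⟩ := exists_eigenfunctional_of_isCoatom θ hH₀.1.1
    (by rw [hH₀.1.2]; omega) hH₀.2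
  rw [hH₀.1.2] at hcard
  have hfin : Finite F := Nat.finite_of_card_ne_zero (by omega)
  have hne := hn₀ φ₀ hsurj (by omega)
  simp only [Int.cast_mul, Int.cast_prod, ne_eq, mul_eq_zero, not_or, Finset.prod_eq_zero_iff,
    Finset.mem_univ, true_and, not_exists] at hne
  obtain ⟨⟨⟨hEF, hDF⟩, hsF⟩, hbF⟩ := hne
  have hcut : ∀ H ∈ M₂, ∃ (φ : N →+ F) (α c : F), IsCutOutBy θ H φ α c := by
    intro H hH
    obtain ⟨F', _, φ, α, c, hcard', h1, h2, h3, h4⟩ := exists_eigenfunctional_of_isCoatom θ hH.1.1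
      (by rw [hH.1.2]; omega) hH.2
    rw [hH.1.2] at hcard'
    have : Finite F' := Nat.finite_of_card_ne_zero (by omega)
    have := Fintype.ofFinite F
    have := Fintype.ofFinite F'
    let e : F' ≃+* F := FiniteField.ringEquivOfCardEq (by
      rw [← Nat.card_eq_fintype_card, ← Nat.card_eq_fintype_card, hcard, hcard'])
    exact ⟨_, _, _, IsCutOutBy.transport ⟨h1, h2, h3, h4⟩ e⟩
  classical
  let T : Finset (Fin d) → (Fin d → F) → Finset F → Set (Subgroup (abelianByZ N θ)) :=
    fun t y R => {H | ∃ (φ : N →+ F) (α c : F), α ∈ R ∧ (∀ i ∈ t, φ (u i) = y i) ∧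
      IsCutOutBy θ H φ α c}
  let R : ℤ[X] → Finset F := fun p => (p.map (Int.castRingHom F)).roots.toFinset
  have hR : ∀ p, (R p).card ≤ p.natDegree := fun p =>
    (Multiset.toFinset_card_le _).trans ((card_roots' _).trans natDegree_map_le)
  have hT : ∀ t y p, (T t y (R p)).Finite ∧
      (T t y (R p)).ncard ≤ p.natDegree * (n ^ (d - t.card) * n) := by
    intro t y p
    have := finite_and_ncard_le_of_isCutOutBy θ u E hEF hgen t y (R p)
    rw [hcard] at this
    exact ⟨this.1, this.2.trans (Nat.mul_le_mul_right _ (hR p))⟩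
  let z : Fin d := ⟨0, hd⟩
  let T₀ := T {z} 1 (R s)
  let T' : {j : Fin d // j ≠ z} → Set (Subgroup (abelianByZ N θ)) := fun j =>
    T {z, j.1} (Pi.single j.1 1) (R (b j))
  have hcover : M₂ ⊆ T₀ ∪ ⋃ j, T' j := by
    intro H hH
    obtain ⟨φ, α, c, h⟩ := hcut H hH
    by_cases hz : φ (u z) = 0
    · obtain ⟨j, hj⟩ : ∃ j, φ (u j) ≠ 0 := by
        by_contra! hall
        obtain ⟨v, hv⟩ := h.surjective 1
        obtain ⟨p, hp⟩ := hgen v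
        refine hEF ?_
        rw [← mul_one (E : F), ← hv, ← zsmul_eq_mul, ← map_zsmul, hp, map_sum]
        refine Finset.sum_eq_zero fun j _ => ?_
        rw [map_aeval_eq_mul _ φ α h.map_eq, hall, mul_zero]
      have hjz : j ≠ z := fun h => hj (h ▸ hz)
      have h' := h.scale (inv_ne_zero hj)
      have h1 : ((AddMonoidHom.mulLeft (φ (u j))⁻¹).comp φ) (u j) = 1 := by simp [hj]
      refine Or.inr (Set.mem_iUnion.mpr ⟨⟨j, hjz⟩, _, _, _, ?_, ?_, h'⟩)
      · rw [Multiset.mem_toFinset]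
        exact mem_roots_map_of_isCutOutBy θ h' h1 (hu j) (D := 1) (by simp) (k := 1) (q := 1)
          (by simp) (hbF j)
      · intro i hi
        rcases Finset.mem_insert.mp hi with rfl | hi
        · simp [hz, hjz.symm]
        · rw [Finset.mem_singleton.mp hi, h1, Pi.single_eq_same]
    · have h' := h.scale (inv_ne_zero hz)
      have h1 : ((AddMonoidHom.mulLeft (φ (u z))⁻¹).comp φ) (u z) = 1 := by simp [hz]
      refine Or.inl ⟨_, _, _, ?_, ?_, h'⟩
      · rw [Multiset.mem_toFinset]
        exact mem_roots_map_of_isCutOutBy θ h' h1 (hu z) hDF hs hsF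
      · intro i hi
        rw [Finset.mem_singleton.mp hi, h1, Pi.one_apply]
  have hfinite : (T₀ ∪ ⋃ j, T' j).Finite :=
    (hT _ _ _).1.union (Set.finite_iUnion fun j => (hT _ _ _).1)
  refine ⟨hfinite.subset hcover, (Set.ncard_le_ncard hcover hfinite).trans
    ((Set.ncard_union_le _ _).trans (add_le_add ?_ ?_))⟩
  · refine (hT _ _ _).2.trans_eq ?_
    rw [Finset.card_singleton, ← pow_succ, Nat.sub_add_cancel hd]
  · refine (Set.ncard_iUnion_le_of_fintype _).trans ?_
    have hle : ∀ j : {j : Fin d // j ≠ z}, (T' j).ncard ≤ (b j).natDegree * n ^ (d - 1) := by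
      intro j
      refine (hT _ _ _).2.trans_eq ?_
      have hd2 : 2 ≤ d := by
        have h1 := j.1.2
        have h2 : j.1.val ≠ 0 := fun h => j.2 (Fin.ext h)
        omega
      rw [Finset.card_pair j.2.symm, ← pow_succ]
      congr 2
      omega
    refine (Finset.sum_le_sum fun j _ => hle j).trans ?_
    rw [← Fintype.sum_subtype_add_sum_subtype (fun j => j ≠ z)
      fun j => (b j).natDegree * n ^ (d - 1)]
    exact Nat.le_add_right _ _

theorem card_mul_pow_le_ncard_isCoatom {d : ℕ} (hd : 0 < d) (p : ℕ) [Fact p.Prime]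
    (hfin : {H : Subgroup (abelianByZ N θ) | IsCoatom H ∧ H.index = p}.Finite)
    {I : Type*} [Finite I] (α : I → ZMod p) (hα : Function.Injective α)
    (ψ : I → Fin d → N →+ ZMod p) (hψ : ∀ i j v, ψ i j (θ v) = α i * ψ i j v) (u : Fin d → N)
    (ε : Fin d → ZMod p) (hε : ∀ j, ε j ≠ 0)
    (hu : ∀ i j l, ψ i j (u l) = if l = j then ε l else 0) :
    Nat.card I * p ^ d ≤ {H : Subgroup (abelianByZ N θ) | IsCoatom H ∧ H.index = p}.ncard := by
  let z : Fin d := ⟨0, hd⟩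
  let φ : I → ({j : Fin d // j ≠ z} → ZMod p) → N →+ ZMod p := fun i y =>
    ψ i z + ∑ j, (AddMonoidHom.mulLeft (y j)).comp (ψ i j)
  have hφ : ∀ i y v, φ i y v = ψ i z v + ∑ j, y j * ψ i j v := fun i y v => by simp [φ]
  have hφz : ∀ i y, φ i y (u z) = ε z := fun i y => by
    rw [hφ, hu, if_pos rfl, Finset.sum_eq_zero, add_zero]
    intro j _
    rw [hu, if_neg j.2.symm, mul_zero]
  have hφu : ∀ i y j, φ i y (u j.1) = y j * ε j := fun i y j => by
    rw [hφ, hu, if_neg j.2, zero_add, Finset.sum_eq_single j]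
    · rw [hu, if_pos rfl]
    · intro l _ hl
      rw [hu, if_neg fun h => hl (Subtype.ext h.symm), mul_zero]
    · simp
  have hφθ : ∀ i y v, φ i y (θ v) = α i * φ i y v := fun i y v => by
    rw [hφ, hφ, mul_add, Finset.mul_sum, hψ]
    congr 1
    refine Finset.sum_congr rfl fun j _ => ?_
    rw [hψ]
    ring
  have hmul : ∀ t : ZMod p, ∃ m : ℤ, t = m * ε z := fun t => by
    obtain ⟨m, hm⟩ := ZMod.intCast_surjective (t / ε z)
    exact ⟨m, by rw [hm, div_mul_cancel₀ _ (hε z)]⟩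
  have hsurj : ∀ i y, Function.Surjective (φ i y) := fun i y t => by
    obtain ⟨m, rfl⟩ := hmul t
    exact ⟨m • u z, by rw [map_zsmul, hφz, zsmul_eq_mul]⟩
  have hα0 : ∀ i, α i ≠ 0 := fun i h => hε z (by
    have := hφθ i 0 (θ.symm (u z))
    rwa [θ.apply_symm_apply, hφz, h, zero_mul] at this)
  choose H hH₁ hH₂ hH₃ using fun (i : I) (y : {j : Fin d // j ≠ z} → ZMod p) (c : ZMod p) =>
    exists_subgroup_of_eigenfunctional θ (φ i y) (α i) c (hα0 i) (hφθ i y) (hsurj i y)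
  have hp : ∀ i y c, (H i y c).index = p := fun i y c => by rw [hH₃, Nat.card_zmod]
  let f : I × ({j : Fin d // j ≠ z} → ZMod p) × ZMod p →
      {H : Subgroup (abelianByZ N θ) | IsCoatom H ∧ H.index = p} := fun x =>
    ⟨H x.1 x.2.1 x.2.2, Subgroup.isCoatom_of_prime_index (by rw [hp]; exact Fact.out), hp _ _ _⟩
  have hf : Function.Injective f := by
    rintro ⟨i, y, c⟩ ⟨i', y', c'⟩ h
    have hHH : H i y c = H i' y' c' := congrArg Subtype.val h
    have hφφ : ∀ v, φ i y v = φ i' y' v := fun v => by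
      obtain ⟨m, hm⟩ := hmul (φ i y v)
      have h0 : φ i y (v - m • u z) = 0 := by
        rw [map_sub, map_zsmul, hφz, hm, zsmul_eq_mul, sub_self]
      rw [← hH₁ i y c, hHH, hH₁, map_sub, map_zsmul, hφz, zsmul_eq_mul, ← hm, sub_eq_zero] at h0
      exact h0.symm
    have hii : i = i' := hα (mul_right_cancel₀ (hε z) (by
      rw [← hφz i y, ← hφθ, hφφ, hφθ, hφz, hφz]))
    have hyy : y = y' := funext fun j => mul_right_cancel₀ (hε j) (by
      rw [← hφu i, hφφ, hφu])
    obtain ⟨v, hv⟩ := hsurj i y c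
    have hcc : φ i' y' v = c' := by rw [← hH₂ i' y' c', ← hHH, hH₂, hv]
    rw [hii, hyy, ← hv, hφφ, hcc]
  have : Finite {H : Subgroup (abelianByZ N θ) | IsCoatom H ∧ H.index = p} := hfin
  rw [← Nat.card_coe_set_eq]
  refine le_of_eq_of_le ?_ (Nat.card_le_card_of_injective f hf)
  rw [Nat.card_prod, Nat.card_prod, Nat.card_fun, Nat.card_zmod,
    Nat.card_eq_fintype_card (α := {j : Fin d // j ≠ z}), Fintype.card_subtype_compl,
    Fintype.card_fin, Fintype.card_unique, ← pow_succ, Nat.sub_add_cancel hd]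

theorem exists_ge_card_roots_mul_pow_le_ncard [AddGroup.FG N] {d : ℕ} (hd : 0 < d)
    (a : Fin d → ℚ[X]) (hdvd : ∀ j, a ⟨0, hd⟩ ∣ a j)
    (ι : N →+ ((j : Fin d) → ℚ[X] ⧸ Ideal.span {a j}))
    (hι : ∀ v, ι (θ v) = (X : ℚ[X]) • ι v) (u : Fin d → N) (δ : Fin d → ℤ) (hδ : ∀ j, δ j ≠ 0)
    (hu : ∀ j, ι (u j) = δ j • Pi.single j 1) {n₀ : ℕ}
    (hfin : ∀ n, n₀ ≤ n → {H : Subgroup (abelianByZ N θ) | IsCoatom H ∧ H.index = n}.Finite)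
    (m : ℕ) :
    ∃ n, m ≤ n ∧ ((a ⟨0, hd⟩).map (algebraMap ℚ ℂ)).roots.toFinset.card * n ^ d ≤
      {H : Subgroup (abelianByZ N θ) | IsCoatom H ∧ H.index = n}.ncard := by
  classical
  set Λ := ((a ⟨0, hd⟩).map (algebraMap ℚ ℂ)).roots.toFinset with hΛ
  have hroot : ∀ x ∈ Λ, aeval x (a ⟨0, hd⟩) = 0 := by
    intro x hx
    have := (mem_roots'.mp (Multiset.mem_toFinset.mp hx)).2
    rwa [IsRoot, eval_map_algebraMap] at this
  have halg : ∀ x ∈ Λ, IsAlgebraic ℚ x := fun x hx => ⟨a ⟨0, hd⟩, by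
    rintro h
    simp [hΛ, h] at hx, hroot x hx⟩
  have hlift : ∀ (x : Λ) (j : Fin d), ∀ f ∈ Ideal.span {a j}, aeval (x : ℂ) f = 0 := by
    intro x j f hf
    obtain ⟨g, rfl⟩ := (hdvd j).trans (Ideal.mem_span_singleton.mp hf)
    rw [map_mul, hroot x x.2, zero_mul]
  let L : (x : Λ) → (j : Fin d) → ℚ[X] ⧸ Ideal.span {a j} →+* ℂ := fun x j =>
    Ideal.Quotient.lift _ (aeval (x : ℂ)).toRingHom (hlift x j)
  have hL : ∀ x j f, L x j (Ideal.Quotient.mk _ f) = aeval (x : ℂ) f := fun x j f => rfl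
  have hLX : ∀ x j w, L x j ((X : ℚ[X]) • w) = x * L x j w := by
    intro x j w
    obtain ⟨f, rfl⟩ := Ideal.Quotient.mk_surjective w
    have : (X : ℚ[X]) • Ideal.Quotient.mk (Ideal.span {a j}) f = Ideal.Quotient.mk _ (X * f) := rfl
    rw [this, hL, hL, map_mul, aeval_X]
  let Ψ : Λ → Fin d → N →+ ℂ := fun x j =>
    (L x j).toAddMonoidHom.comp ((Pi.evalAddMonoidHom _ j).comp ι)
  have hΨ : ∀ x j v, Ψ x j v = L x j (ι v j) := fun _ _ _ => rfl
  have hΨθ : ∀ x j v, Ψ x j (θ v) = x * Ψ x j v := fun x j v => by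
    rw [hΨ, hΨ, hι, Pi.smul_apply, hLX]
  have hΨu : ∀ x j l, Ψ x j (u l) = if l = j then (δ l : ℂ) else 0 := by
    intro x j l
    rw [hΨ, hu, Pi.smul_apply, map_zsmul]
    by_cases hlj : l = j
    · subst hlj
      simp
    · simp [hlj]
  have hΨalg : ∀ x j v, IsAlgebraic ℚ (Ψ x j v) := by
    intro x j v
    obtain ⟨f, hf⟩ := Ideal.Quotient.mk_surjective (ι v j)
    rw [hΨ, ← hf, hL]
    have hx := mem_algebraicClosure_iff.mpr (halg x x.2)
    rw [← IntermediateField.algebraMap_apply (algebraicClosure ℚ ℂ) ⟨x, hx⟩,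
      aeval_algebraMap_apply]
    exact mem_algebraicClosure_iff.mp (aeval (⟨x, hx⟩ : algebraicClosure ℚ ℂ) f).2
  obtain ⟨T, hT⟩ := AddGroup.fg_def.mp ‹AddGroup.FG N›
  let S : Finset ℂ := Λ ∪ (Finset.univ ×ˢ Finset.univ ×ˢ T).image (fun y : Λ × Fin d × N =>
      Ψ y.1 y.2.1 y.2.2) ∪ (Λ ×ˢ Λ).image (fun y => (y.1 - y.2)⁻¹) ∪
    Finset.univ.image (fun j => (δ j : ℂ)⁻¹)
  have hSalg : ∀ s ∈ S, IsAlgebraic ℚ s := by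
    intro s hs
    simp only [S, Finset.mem_union, Finset.mem_image, Finset.mem_product, Finset.mem_univ,
      true_and] at hs
    rcases hs with ((hs | ⟨y, -, rfl⟩) | ⟨y, hy, rfl⟩) | ⟨j, rfl⟩
    · exact halg s hs
    · exact hΨalg _ _ _
    · exact ((halg _ hy.1).sub (halg _ hy.2)).inv
    · exact (isAlgebraic_intCast _).inv
  obtain ⟨p, hp, hpm, ⟨π⟩⟩ := exists_prime_ge_and_ringHom S hSalg (max m n₀)
  have : Fact p.Prime := ⟨hp⟩
  set A := Subring.closure (S : Set ℂ) with hA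
  have hSA : ∀ s ∈ S, s ∈ A := fun s hs => Subring.subset_closure hs
  have hΛA : ∀ x ∈ Λ, x ∈ A := fun x hx => hSA x (by simp [S, hx])
  have hΨA : ∀ x j v, Ψ x j v ∈ A := by
    intro x j v
    have hle : AddSubgroup.closure (T : Set N) ≤ A.toAddSubgroup.comap (Ψ x j) := by
      rw [AddSubgroup.closure_le]
      intro w hw
      refine hSA _ ?_
      simp only [S, Finset.mem_union, Finset.mem_image]
      exact Or.inl (Or.inl (Or.inr ⟨(x, j, w), by simpa using hw, rfl⟩))
    exact hle (by rw [hT]; trivial)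
  have hunit : ∀ s (hs : s ∈ A), s ≠ 0 → s⁻¹ ∈ A → π ⟨s, hs⟩ ≠ 0 := by
    intro s hs hs0 hs' h
    have h1 : π (⟨s, hs⟩ * ⟨s⁻¹, hs'⟩) = 1 := by
      rw [← map_one π]
      congr 1
      exact Subtype.ext (mul_inv_cancel₀ hs0)
    rw [map_mul, h, zero_mul] at h1
    exact zero_ne_one h1
  refine ⟨p, (le_max_left _ _).trans hpm, ?_⟩
  have := card_mul_pow_le_ncard_isCoatom θ hd p (hfin p ((le_max_right _ _).trans hpm))
    (I := Λ) (fun x => π ⟨x, hΛA x x.2⟩) ?_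
    (fun x j => π.toAddMonoidHom.comp ((Ψ x j).codRestrict A (hΨA x j))) ?_ u
    (fun j => (δ j : ZMod p)) ?_ ?_
  · rwa [Nat.card_eq_fintype_card, Fintype.card_coe] at this
  · intro x y hxy
    by_contra hne
    refine hunit (x - y) (A.sub_mem (hΛA x x.2) (hΛA y y.2))
      (sub_ne_zero.mpr fun h => hne (Subtype.ext h)) ?_ ?_
    · refine hSA _ ?_
      simp only [S, Finset.mem_union, Finset.mem_image]
      exact Or.inl (Or.inr ⟨(x, y), by simp, rfl⟩)
    · have : (⟨(x : ℂ) - y, A.sub_mem (hΛA x x.2) (hΛA y y.2)⟩ : A) =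
        ⟨x, hΛA x x.2⟩ - ⟨y, hΛA y y.2⟩ := rfl
      rw [this, map_sub]
      exact sub_eq_zero.mpr hxy
  · intro x j v
    have : (Ψ x j).codRestrict A (hΨA x j) (θ v) =
        ⟨x, hΛA x x.2⟩ * (Ψ x j).codRestrict A (hΨA x j) v := Subtype.ext (hΨθ x j v)
    change π _ = _ * π _
    rw [this, map_mul]
  · intro j
    have h := hunit (δ j) (intCast_mem A _) (by exact_mod_cast hδ j) (hSA _ (by simp [S]))
    have h1 : (⟨(δ j : ℂ), intCast_mem A _⟩ : A) = (δ j : A) := rfl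
    rwa [h1, map_intCast] at h
  · intro x j l
    have : (Ψ x j).codRestrict A (hΨA x j) (u l) = if l = j then (δ l : A) else 0 := by
      refine Subtype.ext ((hΨu x j l).trans ?_)
      split_ifs <;> rfl
    change π _ = _
    rw [this]
    split_ifs <;> simp

end abelianByZ

theorem stmt0 {N : Type*} [AddCommGroup N] [AddGroup.FG N] (θ : N ≃+ N)
    (d : ℕ) (hd : 0 < d) (a : Fin d → ℚ[X])
    (hdvd : ∀ i j : Fin d, i ≤ j → a i ∣ a j)
    (hnu : ¬ IsUnit (a ⟨0, hd⟩))
    -- `ℚ ⊗_ℤ N`, as a `ℚ[x]`-module in which `x` acts via `θ`, decomposes as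
    -- `⊕_{j=1}^d ℚ[x]/(a_j)`
    (hiso : Nonempty
      ((Module.AEval' (LinearMap.baseChange ℚ θ.toAddMonoidHom.toIntLinearMap)) ≃ₗ[ℚ[X]]
        ((j : Fin d) → ℚ[X] ⧸ Ideal.span {a j})))
    (ρ₁ : ℕ)
    (hρ : ρ₁ = ((a ⟨0, hd⟩).map (algebraMap ℚ ℂ)).roots.toFinset.card) :
    (∃ C : ℝ, ∃ n₀ : ℕ, ∀ n : ℕ, n₀ ≤ n →
      (maxSubgroupCount (abelianByZ N θ) n : ℝ) ≤ ρ₁ * (n : ℝ) ^ d + C * (n : ℝ) ^ (d - 1)) ∧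
    (∀ m : ℕ, ∃ n : ℕ, m ≤ n ∧
      (ρ₁ : ℝ) * (n : ℝ) ^ d ≤ (maxSubgroupCount (abelianByZ N θ) n : ℝ)) := by
  obtain ⟨ha, ι, hι, hker, hcoker⟩ := exists_rationalization θ a hiso
  obtain ⟨u, b, δ, E, hE, hδ, hb, hbu, hιu, hgen⟩ :=
    exists_cyclic_generators θ.toAddMonoidHom.toIntLinearMap a ι hι hker hcoker
  have hb0 : ∀ j, b j ≠ 0 := fun j h => by
    obtain ⟨β, hβ, hβb⟩ := hb j
    rw [h, Polynomial.map_zero, eq_comm, mul_eq_zero, C_eq_zero, Int.cast_eq_zero] at hβb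
    exact hβb.elim hβ (ha j)
  obtain ⟨β, hβ, hβb⟩ := hb ⟨0, hd⟩
  obtain ⟨s, hs0, hsdeg, D, hD, k, q, hs⟩ :=
    exists_natDegree_le_card_roots_dvd_pow (ha ⟨0, hd⟩) hβ hβb
  obtain ⟨n₀, hn₀⟩ := abelianByZ.exists_forall_ge_ncard_isCoatom_le θ hd u b hb0 hbu E hE hgen s hs0
    D hD k q hs
  rw [← hρ] at hsdeg
  have hcount : ∀ n, maxSubgroupCount (abelianByZ N θ) n =
      {H : Subgroup (abelianByZ N θ) | IsCoatom H ∧ H.index = n}.ncard := fun n => rfl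
  refine ⟨⟨1 + ∑ j, ((b j).natDegree : ℝ), n₀ + 1, fun n hn => ?_⟩, fun m => ?_⟩
  · have h1 : maxSubgroupCount (abelianByZ N θ) n ≤
        1 * n ^ (d - 1) + ρ₁ * n ^ d + ∑ j, (b j).natDegree * n ^ (d - 1) := by
      rw [hcount]
      refine (hn₀ n (by omega)).2.trans ?_
      gcongr
      rw [one_mul]
      exact Nat.one_le_pow _ _ (by omega)
    have h2 : (maxSubgroupCount (abelianByZ N θ) n : ℝ) ≤ 1 * (n : ℝ) ^ (d - 1) + ρ₁ * (n : ℝ) ^ d +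
        ∑ j, ((b j).natDegree : ℝ) * (n : ℝ) ^ (d - 1) := by exact_mod_cast h1
    rw [← Finset.sum_mul] at h2
    linarith
  · obtain ⟨n, hmn, hn⟩ := abelianByZ.exists_ge_card_roots_mul_pow_le_ncard θ hd a
      (fun j => hdvd _ j (Nat.zero_le _)) ι hι u δ hδ hιu (fun n hn => (hn₀ n hn).1) m
    rw [← hρ, ← hcount] at hn
    exact ⟨n, hmn, by exact_mod_cast hn⟩
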